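/- Small-interval estimate (Lemma 3.2 of Kerimkulov–Šiška–Szpruch, used in the proof of Theorem 3.5 of the paper). Let T > 0 and let g : ℝ → ℝ be integrable on [0,T] with g(t) ≤ 0 for almost every t ∈ [0,T]. Set μ = ∫_0^T g(t) dt and assume −1 ≤ μ (so μ ∈ [−1, 0]). Then there exists t* ∈ [0,T] such that ∫_{max(0, t* − |μ|T)}^{min(T, t* + |μ|T)} g(s) ds ≤ −μ². -/

import Mathlib

open MeasureTheory

/-- For `x ≥ 1`, the floor `n = ⌊x⌋₊` satisfies `n ≤ x ≤ 2 * n`. -/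
lemma exists_nat_le_and_le_two_mul {x : ℝ} (hx : 1 ≤ x) :
    ∃ n : ℕ, 0 < n ∧ (n : ℝ) ≤ x ∧ x ≤ 2 * n := by
  have hpos : 0 < ⌊x⌋₊ := Nat.floor_pos.mpr hx
  refine ⟨⌊x⌋₊, hpos, Nat.floor_le (by linarith), ?_⟩
  have h1 : (1 : ℝ) ≤ ⌊x⌋₊ := by exact_mod_cast hpos
  linarith [Nat.lt_floor_add_one x]

/-- One of the `n` equal subintervals of `[0, T]` carries at most the average share of the
integral. -/
lemma exists_integral_subinterval_le {T : ℝ} (hT : 0 ≤ T) {g : ℝ → ℝ}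
    (hg : IntervalIntegrable g volume 0 T) {n : ℕ} (hn : 0 < n) :
    ∃ k < n, ∫ s in (k * (T / n))..((k + 1) * (T / n)), g s ≤ (∫ s in (0 : ℝ)..T, g s) / n := by
  have hn' : (0 : ℝ) < n := by exact_mod_cast hn
  have hL : 0 ≤ T / n := by positivity
  have hend : (n : ℝ) * (T / n) = T := by field_simp
  have hle : ∀ k ≤ n, (k : ℝ) * (T / n) ∈ Set.uIcc 0 T := by
    intro k hk
    rw [Set.uIcc_of_le hT]
    refine ⟨by positivity, ?_⟩
    calc (k : ℝ) * (T / n) ≤ n * (T / n) := by gcongr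
      _ = T := hend
  have hsum := intervalIntegral.sum_integral_adjacent_intervals (f := g) (μ := volume)
    (a := fun k : ℕ => (k : ℝ) * (T / n)) (n := n) fun k hk =>
      hg.mono_set (Set.uIcc_subset_uIcc (hle k hk.le) (hle (k + 1) hk))
  simp only [Nat.cast_zero, zero_mul, hend, Nat.cast_add, Nat.cast_one] at hsum
  obtain ⟨k, hk, h⟩ := Finset.exists_le_of_sum_le (s := Finset.range n)
    (f := fun k : ℕ => ∫ s in (k * (T / n))..((k + 1) * (T / n)), g s)
    (g := fun _ => (∫ s in (0 : ℝ)..T, g s) / n) ⟨0, Finset.mem_range.mpr hn⟩ (by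
      rw [hsum, Finset.sum_const, Finset.card_range, nsmul_eq_mul, mul_div_cancel₀ _ hn'.ne'])
  exact ⟨k, Finset.mem_range.mp hk, h⟩

/-- Small-interval estimate (Lemma 3.2 of Kerimkulov–Šiška–Szpruch). -/
theorem small_interval_estimate (T : ℝ) (hT : 0 < T) (g : ℝ → ℝ)
    (hg : IntervalIntegrable g volume 0 T)
    (hneg : ∀ᵐ t ∂(volume.restrict (Set.Icc (0 : ℝ) T)), g t ≤ 0)
    (μ : ℝ) (hμdef : μ = ∫ t in (0 : ℝ)..T, g t) (hμ : -1 ≤ μ) :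
    ∃ t₀ ∈ Set.Icc (0 : ℝ) T,
      ∫ s in (max 0 (t₀ - |μ| * T))..(min T (t₀ + |μ| * T)), g s ≤ -μ ^ 2 := by
  have hnonneg : 0 ≤ᵐ[volume.restrict (Set.Icc (0 : ℝ) T)] fun t => -g t := by
    filter_upwards [hneg] with t ht
    simpa using ht
  have hμ0 : μ ≤ 0 := by
    have h := intervalIntegral.integral_nonneg_of_ae_restrict hT.le hnonneg
    rw [intervalIntegral.integral_neg, ← hμdef] at h
    linarith
  rcases hμ0.eq_or_lt with rfl | hlt
  · exact ⟨0, ⟨le_rfl, hT.le⟩, by simp [hT.le]⟩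
  rw [abs_of_neg hlt]
  have ha : 0 < -μ := by linarith
  obtain ⟨n, hn, hn1, hn2⟩ :=
    exists_nat_le_and_le_two_mul (x := 1 / (-μ)) (by rw [le_div_iff₀ ha]; linarith)
  rw [le_div_iff₀ ha] at hn1
  rw [div_le_iff₀ ha] at hn2
  have hn' : (0 : ℝ) < n := by exact_mod_cast hn
  obtain ⟨k, hk, hint⟩ := exists_integral_subinterval_le hT.le hg hn
  rw [← hμdef] at hint
  set L := T / n with hLdef
  have hL : 0 < L := by positivity
  have hend : (n : ℝ) * L = T := by rw [hLdef]; field_simp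
  have hk0 : 0 ≤ (k : ℝ) * L := by positivity
  have hkT : ((k : ℝ) + 1) * L ≤ T := by
    rw [← hend]
    gcongr
    exact_mod_cast hk
  have hwidth : L / 2 ≤ -μ * T := by
    rw [← hend]
    nlinarith
  have hshare : μ / n ≤ -μ ^ 2 := by
    rw [div_le_iff₀ hn']
    nlinarith
  refine ⟨(k : ℝ) * L + L / 2, ⟨by linarith, by linarith⟩, ?_⟩
  set c := max 0 ((k : ℝ) * L + L / 2 - -μ * T)
  set d := min T ((k : ℝ) * L + L / 2 + -μ * T)
  have hc0 : 0 ≤ c := le_max_left _ _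
  have hdT : d ≤ T := min_le_left _ _
  have hck : c ≤ k * L := max_le hk0 (by linarith)
  have hkd : ((k : ℝ) + 1) * L ≤ d := le_min hkT (by linarith)
  have hkk : (k : ℝ) * L ≤ (k + 1) * L := by linarith
  have hcd : c ≤ d := hck.trans (hkk.trans hkd)
  have hgcd : IntervalIntegrable g volume c d := hg.mono_set <| by
    rw [Set.uIcc_of_le hcd, Set.uIcc_of_le hT.le]
    exact Set.Icc_subset_Icc hc0 hdT
  have hmono := intervalIntegral.integral_mono_interval hck hkk hkd
    (ae_restrict_of_ae_restrict_of_subset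
      (Set.Ioc_subset_Icc_self.trans (Set.Icc_subset_Icc hc0 hdT)) hnonneg) hgcd.neg
  simp only [intervalIntegral.integral_neg] at hmono
  linarith
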